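/- Let φ ∈ (0, π), σ > 0, and let M_t, M_r be positive integers at least one of which is even. Let ω be a real Gaussian random variable with mean 0 and variance σ², and define the Fejér kernel F_M(x) = (1/M)·(sin(Mπx/2)/sin(πx/2))² for x not an even integer, F_M(x) = M otherwise. Then lim_{L→∞} E[ F_L( 2(cos(φ + ω) − cos φ) ) · F_{M_t}( cos(φ + ω) − cos φ ) · F_{M_r}( cos(φ + ω) − cos φ ) ] = M_t · M_r · h(φ, σ²), where h(x, y) = (1/√(2π·y·sin²x)) · ∑_{i ∈ ℤ} ( exp(−2(iπ)²/y) + exp(−2((i+1)π − x)²/y) ). -/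

import Mathlib

open MeasureTheory ProbabilityTheory Filter
open scoped Classical

/-- The Fejér kernel: `F_M(x) = (1/M)·(sin(Mπx/2)/sin(πx/2))²` for `x` not an even
integer, and `F_M(x) = M` for `x` an even integer. -/
noncomputable def fejer (M : ℕ) (x : ℝ) : ℝ :=
  if ∃ k : ℤ, x = 2 * k then (M : ℝ)
  else (1 / M) * (Real.sin (M * Real.pi * x / 2) / Real.sin (Real.pi * x / 2)) ^ 2

/-- The wrapped-Gaussian factor `h(x, y)` of the paper. -/
noncomputable def hfun (x y : ℝ) : ℝ :=
  (1 / Real.sqrt (2 * Real.pi * y * (Real.sin x) ^ 2)) *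
    ∑' i : ℤ, (Real.exp (-2 * ((i : ℝ) * Real.pi) ^ 2 / y) +
      Real.exp (-2 * (((i : ℝ) + 1) * Real.pi - x) ^ 2 / y))

/-- The Dirichlet kernel, as a sum of cosines. -/
noncomputable def dirichletSum (n : ℕ) (y : ℝ) : ℝ :=
  1 + 2 * ∑ k ∈ Finset.range n, Real.cos (2 * ((k : ℝ) + 1) * y)

lemma sin_mul_dirichletSum (n : ℕ) (y : ℝ) :
    Real.sin y * dirichletSum n y = Real.sin ((2 * n + 1) * y) := by
  induction n with
  | zero => simp [dirichletSum]
  | succ n ih =>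
    have h := Real.sin_sub_sin ((2 * ((n + 1 : ℕ) : ℝ) + 1) * y) ((2 * n + 1) * y)
    rw [← ih] at h
    push_cast at h ⊢
    rw [show ((2 * ((n : ℝ) + 1) + 1) * y - (2 * n + 1) * y) / 2 = y by ring,
      show ((2 * ((n : ℝ) + 1) + 1) * y + (2 * n + 1) * y) / 2 = 2 * ((n : ℝ) + 1) * y by ring] at h
    simp only [dirichletSum, Finset.sum_range_succ] at h ⊢
    linear_combination -h

lemma sin_sq_mul_sum_dirichletSum (M : ℕ) (y : ℝ) :
    Real.sin y ^ 2 * ∑ n ∈ Finset.range M, dirichletSum n y = Real.sin (M * y) ^ 2 := by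
  induction M with
  | zero => simp
  | succ M ih =>
    have h := sin_mul_dirichletSum M y
    rw [Finset.sum_range_succ, mul_add, ih, sq (Real.sin y), mul_assoc, h]
    rw [show (2 * (M : ℝ) + 1) * y = M * y + (M * y + y) by ring]
    push_cast
    rw [show ((M : ℝ) + 1) * y = M * y + y by ring]
    simp only [Real.sin_add, Real.cos_add]
    linear_combination -Real.sin (M * y) ^ 2 * Real.sin_sq_add_cos_sq y

lemma dirichletSum_int_mul_pi (n : ℕ) (j : ℤ) : dirichletSum n (j * Real.pi) = 2 * n + 1 := by
  have h (k : ℕ) : Real.cos (2 * ((k : ℝ) + 1) * (j * Real.pi)) = 1 := by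
    rw [Real.cos_eq_one_iff]
    exact ⟨(k + 1) * j, by push_cast; ring⟩
  simp [dirichletSum, h]
  ring

lemma abs_dirichletSum_le (n : ℕ) (y : ℝ) : |dirichletSum n y| ≤ 2 * n + 1 := by
  have h : |∑ k ∈ Finset.range n, Real.cos (2 * ((k : ℝ) + 1) * y)| ≤ n := by
    refine (Finset.abs_sum_le_sum_abs _ _).trans ?_
    refine (Finset.sum_le_sum fun k _ => Real.abs_cos_le_one _).trans ?_
    simp
  rw [abs_le] at h ⊢
  unfold dirichletSum
  constructor <;> linarith [h.1, h.2]

lemma sum_range_odd (M : ℕ) : ∑ n ∈ Finset.range M, (2 * (n : ℝ) + 1) = (M : ℝ) ^ 2 := by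
  induction M with
  | zero => simp
  | succ M ih => rw [Finset.sum_range_succ, ih]; push_cast; ring

lemma sin_pi_mul_half_eq_zero_iff (x : ℝ) :
    Real.sin (Real.pi * x / 2) = 0 ↔ ∃ k : ℤ, x = 2 * k := by
  rw [Real.sin_eq_zero_iff]
  refine exists_congr fun k => ?_
  have := Real.pi_pos
  constructor
  · intro h
    have : Real.pi * (x - 2 * k) = 0 := by linarith
    rcases mul_eq_zero.1 this with h | h <;> linarith
  · rintro rfl
    ring

/-- The Fejér kernel is a Cesàro mean of Dirichlet kernels. -/
lemma fejer_eq_sum (M : ℕ) (x : ℝ) :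
    fejer M x = (1 / M) * ∑ n ∈ Finset.range M, dirichletSum n (Real.pi * x / 2) := by
  unfold fejer
  split_ifs with h
  · obtain ⟨k, rfl⟩ := h
    rw [show Real.pi * (2 * (k : ℝ)) / 2 = k * Real.pi by ring]
    simp only [dirichletSum_int_mul_pi, sum_range_odd]
    rcases eq_or_ne (M : ℝ) 0 with h | h
    · simp [h]
    · field_simp
  · rw [← sin_pi_mul_half_eq_zero_iff] at h
    rw [div_pow, show (M : ℝ) * Real.pi * x / 2 = M * (Real.pi * x / 2) by ring,
      ← sin_sq_mul_sum_dirichletSum]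
    field_simp

lemma fejer_nonneg (M : ℕ) (x : ℝ) : 0 ≤ fejer M x := by
  unfold fejer
  split_ifs <;> positivity

lemma fejer_le (M : ℕ) (x : ℝ) : fejer M x ≤ M := by
  rw [fejer_eq_sum]
  have h : ∑ n ∈ Finset.range M, dirichletSum n (Real.pi * x / 2) ≤ (M : ℝ) ^ 2 := by
    rw [← sum_range_odd]
    exact Finset.sum_le_sum fun n _ => (le_abs_self _).trans (abs_dirichletSum_le _ _)
  rcases eq_or_ne (M : ℝ) 0 with hM | hM
  · simp [hM]
  · calc (1 / (M : ℝ)) * _ ≤ 1 / M * (M : ℝ) ^ 2 := by gcongr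
      _ = M := by field_simp

lemma fejer_zero (M : ℕ) : fejer M 0 = M := if_pos ⟨0, by simp⟩

lemma continuous_dirichletSum (n : ℕ) : Continuous (dirichletSum n) := by
  unfold dirichletSum
  fun_prop

lemma continuous_fejer (M : ℕ) : Continuous (fejer M) := by
  rw [funext (fejer_eq_sum M)]
  exact continuous_const.mul (continuous_finsetSum _ fun n _ =>
    (continuous_dirichletSum n).comp (by fun_prop))

lemma sin_sq_mul_fejer (M : ℕ) (x : ℝ) :
    Real.sin (Real.pi * x / 2) ^ 2 * fejer M x = 1 / M * Real.sin (M * (Real.pi * x / 2)) ^ 2 := by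
  rw [fejer_eq_sum, ← sin_sq_mul_sum_dirichletSum]
  ring

lemma integral_fejer_two_mul {L : ℕ} (hL : L ≠ 0) :
    ∫ x in (-(1 / 2) : ℝ)..(1 / 2), fejer L (2 * x) = 1 := by
  have hcos (k : ℕ) : ∫ x in (-(1 / 2) : ℝ)..(1 / 2),
      Real.cos (2 * ((k : ℝ) + 1) * (Real.pi * x)) = 0 := by
    have hc : 2 * ((k : ℝ) + 1) * Real.pi ≠ 0 := by positivity
    have := intervalIntegral.integral_comp_mul_left (a := -(1 / 2)) (b := 1 / 2) Real.cos hc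
    simp only [← mul_assoc]
    rw [this, integral_cos,
      show 2 * ((k : ℝ) + 1) * Real.pi * (1 / 2) = (k + 1 : ℕ) * Real.pi by push_cast; ring,
      show 2 * ((k : ℝ) + 1) * Real.pi * -(1 / 2) = (-(k + 1 : ℕ) : ℤ) * Real.pi by push_cast; ring,
      Real.sin_nat_mul_pi, Real.sin_int_mul_pi]
    simp
  have hD (n : ℕ) : ∫ x in (-(1 / 2) : ℝ)..(1 / 2), dirichletSum n (Real.pi * x) = 1 := by
    unfold dirichletSum
    rw [intervalIntegral.integral_add (by simp)
      (Continuous.intervalIntegrable (by fun_prop) _ _), intervalIntegral.integral_const_mul,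
      intervalIntegral.integral_finsetSum
        fun k _ => Continuous.intervalIntegrable (by fun_prop) _ _]
    simp only [hcos]
    norm_num
  have hfi (n : ℕ) : IntervalIntegrable (fun x => dirichletSum n (Real.pi * x)) volume
      (-(1 / 2)) (1 / 2) :=
    ((continuous_dirichletSum n).comp (by fun_prop)).intervalIntegrable _ _
  simp only [fejer_eq_sum, show ∀ x : ℝ, Real.pi * (2 * x) / 2 = Real.pi * x from fun x => by ring]
  rw [intervalIntegral.integral_const_mul, intervalIntegral.integral_finsetSum fun n _ => hfi n]
  simp only [hD]
  simp [hL]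

lemma fejer_two_mul_le {L : ℕ} {x c : ℝ} (hc : 0 < c) (hx : c ≤ Real.sin (Real.pi * x) ^ 2) :
    fejer L (2 * x) ≤ 1 / c * (1 / L) := by
  have h := sin_sq_mul_fejer L (2 * x)
  rw [show Real.pi * (2 * x) / 2 = Real.pi * x by ring] at h
  have h1 : c * fejer L (2 * x) ≤ 1 / L :=
    (mul_le_mul_of_nonneg_right hx (fejer_nonneg _ _)).trans
      (h.le.trans (mul_le_of_le_one_right (by positivity) (Real.sin_sq_le_one _)))
  rw [one_div, inv_mul_eq_div, le_div_iff₀ hc]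
  linarith

lemma tendstoUniformlyOn_zero_of_le_div {s : Set ℝ} {f : ℕ → ℝ → ℝ} {C : ℝ}
    (h0 : ∀ L, ∀ x ∈ s, 0 ≤ f L x) (h : ∀ L, ∀ x ∈ s, f L x ≤ C * (1 / L)) :
    TendstoUniformlyOn f 0 atTop s := by
  have hlim : Tendsto (fun L : ℕ => C * (1 / (L : ℝ))) atTop (nhds 0) := by
    simpa using tendsto_one_div_atTop_nhds_zero_nat.const_mul C
  rw [Metric.tendstoUniformlyOn_iff]
  intro ε hε
  filter_upwards [hlim.eventually_lt_const hε] with L hL x hx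
  simp only [Pi.zero_apply, dist_zero_left, Real.norm_eq_abs, abs_of_nonneg (h0 L x hx)]
  exact (h L x hx).trans_lt hL

lemma tendsto_integral_fejer_mul {g : ℝ → ℝ}
    (hg : IntegrableOn g (Set.Icc (-(1 / 2)) (1 / 2))) (hc : ContinuousAt g 0) :
    Tendsto (fun L : ℕ => ∫ x in Set.Icc (-(1 / 2) : ℝ) (1 / 2), fejer L (2 * x) * g x)
      atTop (nhds (g 0)) := by
  refine tendsto_setIntegral_peak_smul_of_integrableOn_of_tendsto (x₀ := 0)
    (φ := fun (L : ℕ) x => fejer L (2 * x))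
    measurableSet_Icc measurableSet_Icc subset_rfl self_mem_nhdsWithin (by simp)
    (Eventually.of_forall fun L x _ => fejer_nonneg _ _) ?_ ?_
    (Eventually.of_forall fun L =>
      ((continuous_fejer L).comp (by fun_prop)).aestronglyMeasurable) hg
    (hc.tendsto.mono_left nhdsWithin_le_nhds)
  · intro u hu h0
    have hK : IsCompact (Set.Icc (-(1 / 2) : ℝ) (1 / 2) \ u) := isCompact_Icc.diff hu
    obtain ⟨c, hc, hcu⟩ := hK.exists_forall_le' (f := fun x => Real.sin (Real.pi * x) ^ 2) (a := 0)
      (by fun_prop) (fun x hx => by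
        have hx0 : x ≠ 0 := fun h => hx.2 (h ▸ h0)
        have hpi := Real.pi_pos
        have : Real.sin (Real.pi * x) ≠ 0 := by
          intro h
          rw [Real.sin_eq_zero_iff_of_lt_of_lt (by nlinarith [hx.1.1]) (by nlinarith [hx.1.2])] at h
          rcases mul_eq_zero.1 h with h | h
          · exact hpi.ne' h
          · exact hx0 h
        positivity)
    exact tendstoUniformlyOn_zero_of_le_div (fun L x _ => fejer_nonneg _ _)
      fun L x hx => fejer_two_mul_le hc (hcu x hx)
  · refine tendsto_const_nhds.congr' ?_
    filter_upwards [eventually_ne_atTop 0] with L hL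
    rw [integral_Icc_eq_integral_Ioc, ← intervalIntegral.integral_of_le (by norm_num),
      integral_fejer_two_mul hL]

/-- Local form of the concentration of `F_L(2(cos t - cos φ))` at `t = φ`. -/
lemma tendsto_integral_fejer_cos_near {φ δ : ℝ} (hδ : 0 < δ) (hδ' : δ ≤ 1 / 2)
    (h0 : 0 < φ - δ) (hpi : φ + δ < Real.pi) {G : ℝ → ℝ} (hG : Continuous G) :
    Tendsto (fun L : ℕ => ∫ t in Set.Icc (φ - δ) (φ + δ),
        fejer L (2 * (Real.cos t - Real.cos φ)) * G (Real.cos t - Real.cos φ))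
      atTop (nhds (G 0 / Real.sin φ)) := by
  set u : ℝ → ℝ := fun t => Real.cos t - Real.cos φ with hu
  set H : ℝ → ℝ := fun x => G x / √(1 - (x + Real.cos φ) ^ 2) with hH
  have hanti : ∀ {x y : ℝ}, 0 ≤ x → y ≤ Real.pi → x < y → Real.cos y < Real.cos x :=
    fun hx hy hxy => Real.cos_lt_cos_of_nonneg_of_le_pi hx hy hxy
  have ha : u (φ + δ) < 0 := sub_neg.2 (hanti (by linarith) hpi.le (by linarith))
  have hb : 0 < u (φ - δ) := sub_pos.2 (hanti h0.le (by linarith) (by linarith))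
  have ha' : -(1 / 2) ≤ u (φ + δ) := by
    have h := Real.abs_cos_sub_cos_le (φ + δ) φ
    rw [add_sub_cancel_left, abs_of_pos hδ] at h
    have := (abs_le.1 h).1
    simp only [hu]; linarith
  have hb' : u (φ - δ) ≤ 1 / 2 := by
    have h := Real.abs_cos_sub_cos_le (φ - δ) φ
    rw [show φ - δ - φ = -δ by ring, abs_neg, abs_of_pos hδ] at h
    have := (abs_le.1 h).2
    simp only [hu]; linarith
  have hm1 : -1 < Real.cos (φ + δ) := by
    rw [← Real.cos_pi]; exact hanti (by linarith) le_rfl hpi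
  have h1 : Real.cos (φ - δ) < 1 := by
    rw [← Real.cos_zero]; exact hanti le_rfl (by linarith) h0
  have hHc : ContinuousOn H (Set.Icc (u (φ + δ)) (u (φ - δ))) := by
    refine hG.continuousOn.div (by fun_prop) fun x hx => ?_
    have hx1 : -1 < x + Real.cos φ := by have := hx.1; simp only [hu] at this; linarith
    have hx2 : x + Real.cos φ < 1 := by have := hx.2; simp only [hu] at this; linarith
    exact (Real.sqrt_pos.2 (by nlinarith)).ne'
  have himg : u '' Set.uIcc (φ - δ) (φ + δ) ⊆ Set.Icc (u (φ + δ)) (u (φ - δ)) := by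
    rintro _ ⟨t, ht, rfl⟩
    rw [Set.uIcc_of_le (by linarith)] at ht
    constructor
    · exact sub_le_sub_right (Real.cos_le_cos_of_nonneg_of_le_pi (by linarith [ht.1]) hpi.le ht.2) _
    · exact sub_le_sub_right (Real.cos_le_cos_of_nonneg_of_le_pi h0.le (by linarith [ht.2]) ht.1) _
  have hIoc : Set.Ioc (u (φ + δ)) (u (φ - δ)) ⊆ Set.Icc (-(1 / 2)) (1 / 2) := fun x hx =>
    ⟨ha'.trans hx.1.le, hx.2.trans hb'⟩
  have hg : IntegrableOn ((Set.Ioc (u (φ + δ)) (u (φ - δ))).indicator H)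
      (Set.Icc (-(1 / 2)) (1 / 2)) := by
    refine (IntegrableOn.integrable_indicator ?_ measurableSet_Ioc).integrableOn
    exact (hHc.integrableOn_compact isCompact_Icc).mono_set Set.Ioc_subset_Icc_self
  have hev : (Set.Ioc (u (φ + δ)) (u (φ - δ))).indicator H =ᶠ[nhds 0] H := by
    filter_upwards [Ioc_mem_nhds ha hb] with x hx using Set.indicator_of_mem hx _
  have hgc : ContinuousAt ((Set.Ioc (u (φ + δ)) (u (φ - δ))).indicator H) 0 :=
    (hHc.continuousAt (Icc_mem_nhds ha hb)).congr hev.symm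
  have hsin : 0 < Real.sin φ := Real.sin_pos_of_pos_of_lt_pi (by linarith) (by linarith)
  have hH0 : H 0 = G 0 / Real.sin φ := by
    simp only [hH, zero_add]
    rw [← Real.sin_sq, Real.sqrt_sq hsin.le]
  have key := tendsto_integral_fejer_mul hg hgc
  rw [hev.eq_of_nhds, hH0] at key
  refine key.congr fun L => ?_
  have hsub := intervalIntegral.integral_comp_mul_deriv' (a := φ - δ) (b := φ + δ) (f := u)
    (f' := fun t => -Real.sin t) (g := fun x => fejer L (2 * x) * H x)
    (fun t _ => (Real.hasDerivAt_cos t).sub_const _) (by fun_prop)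
    ((((continuous_fejer L).comp (by fun_prop)).continuousOn.mul hHc).mono himg)
  calc _ = ∫ x in Set.Icc (-(1 / 2) : ℝ) (1 / 2),
        (Set.Ioc (u (φ + δ)) (u (φ - δ))).indicator (fun x => fejer L (2 * x) * H x) x := by
        congr 1 with x
        by_cases hx : x ∈ Set.Ioc (u (φ + δ)) (u (φ - δ)) <;> simp [hx]
    _ = ∫ x in (u (φ + δ))..(u (φ - δ)), fejer L (2 * x) * H x := by
        rw [setIntegral_indicator measurableSet_Ioc, Set.inter_eq_right.2 hIoc,
          intervalIntegral.integral_of_le (by linarith)]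
    _ = ∫ t in (φ - δ)..(φ + δ), fejer L (2 * u t) * G (u t) := by
        rw [intervalIntegral.integral_symm, ← hsub, ← intervalIntegral.integral_neg]
        refine intervalIntegral.integral_congr fun t ht => ?_
        rw [Set.uIcc_of_le (by linarith)] at ht
        have hst : 0 < Real.sin t :=
          Real.sin_pos_of_pos_of_lt_pi (by linarith [ht.1]) (by linarith [ht.2])
        simp only [hH, hu, Function.comp, sub_add_cancel]
        rw [← Real.sin_sq, Real.sqrt_sq hst.le]
        field_simp
    _ = _ := by
        rw [integral_Icc_eq_integral_Ioc, intervalIntegral.integral_of_le (by linarith)]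

lemma abs_sin_nat_mul_le (m : ℕ) (x : ℝ) : |Real.sin (m * x)| ≤ m * |Real.sin x| := by
  induction m with
  | zero => simp
  | succ m ih =>
    push_cast
    rw [add_mul, one_mul, Real.sin_add]
    refine (abs_add_le _ _).trans ?_
    rw [abs_mul, abs_mul, add_mul, one_mul]
    exact add_le_add ((mul_le_of_le_one_right (abs_nonneg _) (Real.abs_cos_le_one _)).trans ih)
      (mul_le_of_le_one_left (abs_nonneg _) (Real.abs_cos_le_one _))

/-- For even `M` the zero of `F_M` at odd integers cancels the corresponding pole of the bound
on `F_L(2x)`. -/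
lemma sin_sq_mul_fejer_mul_fejer_le {M : ℕ} (hM : Even M) (L : ℕ) (x : ℝ) :
    Real.sin (Real.pi * x / 2) ^ 2 * (fejer L (2 * x) * fejer M x) ≤ (M : ℝ) ^ 2 * (1 / L) := by
  obtain ⟨m, rfl⟩ := hM
  rcases Nat.eq_zero_or_pos m with rfl | hm
  · have : fejer (0 + 0) x = 0 := le_antisymm (by simpa using fejer_le (0 + 0) x) (fejer_nonneg _ _)
    simp [this]
  have hm1 : (1 : ℝ) ≤ m := by exact_mod_cast hm
  have hL := sin_sq_mul_fejer L (2 * x)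
  have h := sin_sq_mul_fejer (m + m) x
  rw [show Real.pi * (2 * x) / 2 = Real.pi * x by ring] at hL
  push_cast at h ⊢
  rw [show ((m : ℝ) + m) * (Real.pi * x / 2) = m * (Real.pi * x) by ring] at h
  have hsin : Real.sin (m * (Real.pi * x)) ^ 2 ≤ (m : ℝ) ^ 2 * Real.sin (Real.pi * x) ^ 2 := by
    rw [← mul_pow, sq_le_sq, abs_mul, Nat.abs_cast]
    exact abs_sin_nat_mul_le _ _
  have hle : 1 / ((m : ℝ) + m) ≤ 1 := by
    rw [div_le_one (by linarith)]; linarith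
  calc Real.sin (Real.pi * x / 2) ^ 2 * (fejer L (2 * x) * fejer (m + m) x)
      = fejer L (2 * x) * (1 / ((m : ℝ) + m) * Real.sin (m * (Real.pi * x)) ^ 2) := by
        rw [← h]; ring
    _ ≤ fejer L (2 * x) * (1 * ((m : ℝ) ^ 2 * Real.sin (Real.pi * x) ^ 2)) := by
        have := fejer_nonneg L (2 * x)
        gcongr
    _ = (m : ℝ) ^ 2 * (1 / L * Real.sin (L * (Real.pi * x)) ^ 2) := by rw [← hL]; ring
    _ ≤ ((m : ℝ) + m) ^ 2 * (1 / L * 1) := by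
        gcongr
        · linarith
        · exact Real.sin_sq_le_one _
    _ = _ := by ring

lemma sin_half_cos_sub_cos_ne_zero {φ t : ℝ} (hφ : φ ∈ Set.Ioo 0 Real.pi)
    (ht : t ∈ Set.Icc 0 Real.pi) (hne : t ≠ φ) :
    Real.sin (Real.pi * (Real.cos t - Real.cos φ) / 2) ≠ 0 := by
  have hpi := Real.pi_pos
  have h1 : Real.cos φ < 1 := by
    rw [← Real.cos_zero]; exact Real.cos_lt_cos_of_nonneg_of_le_pi le_rfl hφ.2.le hφ.1
  have h2 : -1 < Real.cos φ := by
    rw [← Real.cos_pi]; exact Real.cos_lt_cos_of_nonneg_of_le_pi hφ.1.le le_rfl hφ.2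
  have h3 := Real.cos_le_one t
  have h4 := Real.neg_one_le_cos t
  intro h
  rw [Real.sin_eq_zero_iff_of_lt_of_lt (by nlinarith) (by nlinarith)] at h
  have h5 : Real.cos t = Real.cos φ := by
    have : Real.pi * (Real.cos t - Real.cos φ) = 0 := by linarith
    rcases mul_eq_zero.1 this with h | h <;> linarith
  exact hne (Real.injOn_cos ht (Set.Ioo_subset_Icc_self hφ) h5)

/-- The product of the three array gains, as a function of the cosine difference. -/
noncomputable def echoGain (L M N : ℕ) (x : ℝ) : ℝ := fejer L (2 * x) * fejer M x * fejer N x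

lemma echoGain_nonneg (L M N : ℕ) (x : ℝ) : 0 ≤ echoGain L M N x :=
  mul_nonneg (mul_nonneg (fejer_nonneg _ _) (fejer_nonneg _ _)) (fejer_nonneg _ _)

lemma echoGain_le (L M N : ℕ) (x : ℝ) : echoGain L M N x ≤ L * M * N := by
  unfold echoGain
  have := fejer_nonneg M x
  have := fejer_nonneg N x
  gcongr <;> exact fejer_le _ _

lemma continuous_echoGain (L M N : ℕ) : Continuous (echoGain L M N) :=
  (((continuous_fejer L).comp (by fun_prop)).mul (continuous_fejer M)).mul (continuous_fejer N)

lemma tendsto_integral_echoGain_mul {φ : ℝ} (hφ : φ ∈ Set.Ioo 0 Real.pi) {M N : ℕ} (hM : M ≠ 0)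
    (hN : N ≠ 0) (hev : Even M) {g : ℝ → ℝ} (hg : Continuous g) :
    Tendsto (fun L : ℕ => ∫ t in (0 : ℝ)..Real.pi,
        g t * echoGain L M N (Real.cos t - Real.cos φ))
      atTop (nhds (M * N / Real.sin φ * g φ)) := by
  have hsin : 0 < Real.sin φ := Real.sin_pos_of_pos_of_lt_pi hφ.1 hφ.2
  set c : ℝ := Real.sin φ / (M * N) with hc
  have hc0 : 0 < c := by positivity
  obtain ⟨δ, hδ, hδ'⟩ : ∃ δ > 0, δ < min (1 / 2) (min φ (Real.pi - φ)) :=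
    exists_between (by simp [hφ.1, hφ.2])
  simp only [lt_min_iff] at hδ'
  obtain ⟨hδ1, hδ2, hδ3⟩ := hδ'
  have hpeak : Tendsto (fun L : ℕ => ∫ t in Set.Icc (0 : ℝ) Real.pi,
      (c * echoGain L M N (Real.cos t - Real.cos φ)) • g t) atTop (nhds (g φ)) := by
    refine tendsto_setIntegral_peak_smul_of_integrableOn_of_tendsto (x₀ := φ)
      (t := Set.Icc (φ - δ) (φ + δ))
      (φ := fun (L : ℕ) t => c * echoGain L M N (Real.cos t - Real.cos φ))
      measurableSet_Icc measurableSet_Icc (Set.Icc_subset_Icc (by linarith) (by linarith))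
      (mem_nhdsWithin_of_mem_nhds (Icc_mem_nhds (by linarith) (by linarith)))
      (by simp) (Eventually.of_forall fun L x _ => mul_nonneg hc0.le (echoGain_nonneg _ _ _ _))
      ?_ ?_ (Eventually.of_forall fun L => Continuous.aestronglyMeasurable
        (continuous_const.mul ((continuous_echoGain L M N).comp (by fun_prop))))
      (hg.continuousOn.integrableOn_compact isCompact_Icc)
      (hg.tendsto φ |>.mono_left nhdsWithin_le_nhds)
    · intro U hU hφU
      have hK : IsCompact (Set.Icc 0 Real.pi \ U) := isCompact_Icc.diff hU
      obtain ⟨b, hb, hbU⟩ := hK.exists_forall_le'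
        (f := fun t => Real.sin (Real.pi * (Real.cos t - Real.cos φ) / 2) ^ 2) (a := 0)
        (by fun_prop) (fun t ht => by
          have := sin_half_cos_sub_cos_ne_zero hφ ht.1 fun h => ht.2 (h ▸ hφU)
          positivity)
      refine tendstoUniformlyOn_zero_of_le_div (C := c * (1 / b * (M : ℝ) ^ 2 * N))
        (fun L x _ => mul_nonneg hc0.le (echoGain_nonneg _ _ _ _)) fun L t ht => ?_
      set x := Real.cos t - Real.cos φ
      have hnn : 0 ≤ fejer L (2 * x) * fejer M x :=
        mul_nonneg (fejer_nonneg _ _) (fejer_nonneg _ _)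
      have h1 : fejer L (2 * x) * fejer M x ≤ 1 / b * ((M : ℝ) ^ 2 * (1 / L)) := by
        rw [one_div, inv_mul_eq_div, le_div_iff₀ hb, mul_comm]
        exact (mul_le_mul_of_nonneg_right (hbU t ht) hnn).trans
          (sin_sq_mul_fejer_mul_fejer_le hev L x)
      calc c * echoGain L M N x ≤ c * (1 / b * ((M : ℝ) ^ 2 * (1 / L)) * N) := by
            unfold echoGain
            have := fejer_nonneg N x
            gcongr
            exact fejer_le _ _
        _ = _ := by ring
    · have h := (tendsto_integral_fejer_cos_near (φ := φ) hδ hδ1.le (by linarith) (by linarith)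
        ((continuous_fejer M).mul (continuous_fejer N))).const_mul c
      simp only [Pi.mul_apply, fejer_zero] at h
      rw [show c * ((M : ℝ) * N / Real.sin φ) = 1 by rw [hc]; field_simp] at h
      refine h.congr fun L => ?_
      rw [integral_const_mul]
      simp only [echoGain, mul_assoc]
  have h := hpeak.const_mul c⁻¹
  rw [show (M * N / Real.sin φ : ℝ) = c⁻¹ by rw [hc, inv_div]]
  refine h.congr fun L => ?_
  rw [intervalIntegral.integral_of_le Real.pi_pos.le, ← integral_Icc_eq_integral_Ioc,
    ← integral_const_mul]
  congr 1 with t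
  rw [smul_eq_mul]
  field_simp

/-- Folding of an integral over the line onto a half period of the cosine. -/
lemma hasSum_integral_mul_comp_cos {p k : ℝ → ℝ} (hp : Continuous p) (hk : Continuous k) (φ : ℝ)
    (hfi : Integrable fun ω => p ω * k (Real.cos (φ + ω))) :
    HasSum (fun i : ℤ => ∫ t in (0 : ℝ)..Real.pi,
        (p (2 * Real.pi * i + (t - φ)) + p (2 * Real.pi * i + (2 * Real.pi - t - φ))) *
          k (Real.cos t))
      (∫ ω, p ω * k (Real.cos (φ + ω))) := by
  have hpi := Real.two_pi_pos
  set f : ℝ → ℝ := fun ω => p ω * k (Real.cos (φ + ω)) with hf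
  have hfc : Continuous f := by fun_prop
  have h := ((hfi.comp_sub_right φ).comp_mul_left' hpi.ne').hasSum_intervalIntegral_comp_add_int
  have hE : 2 * Real.pi * ∫ x, f (2 * Real.pi * x - φ) = ∫ x, f x := by
    rw [Measure.integral_comp_mul_left (fun y => f (y - φ)), integral_sub_right_eq_self f φ,
      abs_of_pos (by positivity), smul_eq_mul]
    field_simp
  rw [← hE]
  refine (h.mul_left (2 * Real.pi)).congr_fun fun i => ?_
  have h1 : 2 * Real.pi * ∫ x in (0 : ℝ)..1, f (2 * Real.pi * (x + i) - φ) =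
      ∫ y in (0 : ℝ)..2 * Real.pi, f (2 * Real.pi * i + (y - φ)) := by
    have := intervalIntegral.mul_integral_comp_mul_left (a := 0) (b := 1)
      (f := fun y => f (2 * Real.pi * i + (y - φ))) (2 * Real.pi)
    rw [mul_zero, mul_one] at this
    rw [← this]
    congr 2 with x
    congr 1
    ring
  have h2 : ∫ y in Real.pi..2 * Real.pi, f (2 * Real.pi * i + (y - φ)) =
      ∫ t in (0 : ℝ)..Real.pi, f (2 * Real.pi * i + (2 * Real.pi - t - φ)) := by
    rw [intervalIntegral.integral_comp_sub_left (fun y => f (2 * Real.pi * i + (y - φ)))]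
    congr 1 <;> ring
  have hci (a b : ℝ) : IntervalIntegrable (fun y => f (2 * Real.pi * i + (y - φ))) volume a b :=
    Continuous.intervalIntegrable (by fun_prop) _ _
  rw [h1, ← intervalIntegral.integral_add_adjacent_intervals (hci 0 Real.pi) (hci _ _), h2,
    ← intervalIntegral.integral_add (hci _ _) (Continuous.intervalIntegrable (by fun_prop) _ _)]
  congr 1 with t
  have hc1 : Real.cos (φ + (2 * Real.pi * i + (t - φ))) = Real.cos t := by
    rw [show φ + (2 * Real.pi * i + (t - φ)) = t + i * (2 * Real.pi) by ring,
      Real.cos_add_int_mul_two_pi]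
  have hc2 : Real.cos (φ + (2 * Real.pi * i + (2 * Real.pi - t - φ))) = Real.cos t := by
    rw [show φ + (2 * Real.pi * i + (2 * Real.pi - t - φ)) =
      -t + (i + 1 : ℤ) * (2 * Real.pi) by push_cast; ring,
      Real.cos_add_int_mul_two_pi, Real.cos_neg]
  simp only [hf, hc1, hc2]
  ring

/-- A summable bound on the Gaussian density over the translates of an interval. -/
lemma exists_summable_bound_gaussianPDFReal {v : NNReal} (hv : v ≠ 0) :
    ∃ b : ℤ → ℝ, Summable b ∧ ∀ (i : ℤ) (τ : ℝ), |τ| ≤ 2 * Real.pi →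
      gaussianPDFReal 0 v (2 * Real.pi * i + τ) ≤ b i := by
  have hv0 : (0 : ℝ) < v := by positivity
  have hpi := Real.pi_pos
  refine ⟨fun i => (√(2 * Real.pi * v))⁻¹ * Real.exp (2 * Real.pi ^ 2 / v) *
    HurwitzKernelBounds.f_int 0 0 (Real.pi / v) i,
    (HurwitzKernelBounds.summable_f_int 0 0 (by positivity)).mul_left _, fun i τ hτ => ?_⟩
  have hτ2 : τ ^ 2 ≤ (2 * Real.pi) ^ 2 := sq_le_sq' (abs_le.1 hτ).1 (abs_le.1 hτ).2
  simp only [gaussianPDFReal, HurwitzKernelBounds.f_int, pow_zero, one_mul, mul_assoc,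
    ← Real.exp_add]
  gcongr
  rw [← sub_nonneg]
  have : 2 * Real.pi ^ 2 / v + -Real.pi * ((i + 0) ^ 2 * (Real.pi / v)) -
      -(2 * (Real.pi * i) + τ - 0) ^ 2 / (2 * v) =
      ((2 * (Real.pi * i) + 2 * τ) ^ 2 + 2 * ((2 * Real.pi) ^ 2 - τ ^ 2)) / (4 * v) := by
    field_simp
    ring
  rw [this]
  exact div_nonneg (add_nonneg (sq_nonneg _) (by linarith)) (by linarith)

lemma tendsto_integral_echoGain_gaussianReal {φ : ℝ} (hφ : φ ∈ Set.Ioo 0 Real.pi) {v : NNReal}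
    (hv : v ≠ 0) {M N : ℕ} (hM : M ≠ 0) (hN : N ≠ 0) (hev : Even M) :
    Tendsto (fun L : ℕ =>
        ∫ ω, echoGain L M N (Real.cos (φ + ω) - Real.cos φ) ∂(gaussianReal 0 v))
      atTop (nhds (M * N * hfun φ v)) := by
  set p := gaussianPDFReal 0 v with hp
  have hpc : Continuous p := by
    rw [hp, gaussianPDFReal_def]
    fun_prop
  have hp0 : ∀ x, 0 ≤ p x := gaussianPDFReal_nonneg 0 v
  have hpi := Real.pi_pos
  have hkc (L : ℕ) : Continuous fun x => echoGain L M N (x - Real.cos φ) :=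
    (continuous_echoGain L M N).comp (by fun_prop)
  have hsum (L : ℕ) := hasSum_integral_mul_comp_cos hpc (hkc L) φ (by
    refine (integrable_gaussianPDFReal 0 v).mul_bdd (c := L * M * N)
      ((hkc L).comp (by fun_prop)).aestronglyMeasurable (Eventually.of_forall fun ω => ?_)
    rw [Real.norm_of_nonneg (echoGain_nonneg _ _ _ _)]
    exact echoGain_le _ _ _ _)
  obtain ⟨b, hb, hpb⟩ := exists_summable_bound_gaussianPDFReal hv
  have hone := tendsto_integral_echoGain_mul hφ hM hN hev (g := fun _ => 1) continuous_const
  obtain ⟨B, hB⟩ : ∃ B, ∀ᶠ L : ℕ in atTop,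
      ∫ t in (0 : ℝ)..Real.pi, echoGain L M N (Real.cos t - Real.cos φ) ≤ B := by
    simp only [one_mul] at hone
    exact ⟨_, (hone.eventually_lt_const (lt_add_one _)).mono fun _ h => h.le⟩
  have hkt (L : ℕ) : Continuous fun t => echoGain L M N (Real.cos t - Real.cos φ) :=
    (hkc L).comp Real.continuous_cos
  have key := tendsto_tsum_of_dominated_convergence
    (f := fun (L : ℕ) (i : ℤ) => ∫ t in (0 : ℝ)..Real.pi,
        (p (2 * Real.pi * i + (t - φ)) + p (2 * Real.pi * i + (2 * Real.pi - t - φ))) *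
          echoGain L M N (Real.cos t - Real.cos φ))
    (bound := fun i => (b i + b i) * B) (𝓕 := atTop) ((hb.add hb).mul_right B)
    (fun i => tendsto_integral_echoGain_mul hφ hM hN hev (by fun_prop))
    (by
      filter_upwards [hB] with L hL i
      have hle : ∀ t ∈ Set.Icc 0 Real.pi,
          p (2 * Real.pi * i + (t - φ)) + p (2 * Real.pi * i + (2 * Real.pi - t - φ)) ≤
            b i + b i := fun t ht =>
        add_le_add
          (hpb i _ (abs_le.2 ⟨by linarith [ht.1, hφ.2], by linarith [ht.2, hφ.1]⟩))
          (hpb i _ (abs_le.2 ⟨by linarith [ht.2, hφ.2], by linarith [ht.1, hφ.1]⟩))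
      have hbi : 0 ≤ b i + b i :=
        (add_nonneg (hp0 _) (hp0 _)).trans (hle 0 ⟨le_rfl, hpi.le⟩)
      rw [Real.norm_of_nonneg (intervalIntegral.integral_nonneg hpi.le fun t _ =>
        mul_nonneg (add_nonneg (hp0 _) (hp0 _)) (echoGain_nonneg _ _ _ _))]
      refine le_trans ?_ (mul_le_mul_of_nonneg_left hL hbi)
      rw [← intervalIntegral.integral_const_mul]
      refine intervalIntegral.integral_mono_on hpi.le
        (Continuous.intervalIntegrable (Continuous.mul (by fun_prop) (hkt L)) _ _)
        (Continuous.intervalIntegrable (continuous_const.mul (hkt L)) _ _) fun t ht =>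
        mul_le_mul_of_nonneg_right (hle t ht) (echoGain_nonneg _ _ _ _))
  have hlim : ∑' i : ℤ, (M * N / Real.sin φ *
      (p (2 * Real.pi * i + (φ - φ)) + p (2 * Real.pi * i + (2 * Real.pi - φ - φ)))) =
      M * N * hfun φ v := by
    have hsin : 0 < Real.sin φ := Real.sin_pos_of_pos_of_lt_pi hφ.1 hφ.2
    have hv0 : (0 : ℝ) < v := by positivity
    rw [hfun, Real.sqrt_mul (by positivity), Real.sqrt_sq hsin.le, ← tsum_mul_left,
      ← tsum_mul_left]
    refine tsum_congr fun i => ?_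
    have e1 : -(2 * Real.pi * i + (φ - φ) - 0) ^ 2 / (2 * v) = -2 * (i * Real.pi) ^ 2 / (v : ℝ) := by
      field_simp
      ring
    have e2 : -(2 * Real.pi * i + (2 * Real.pi - φ - φ) - 0) ^ 2 / (2 * v) =
        -2 * ((i + 1) * Real.pi - φ) ^ 2 / (v : ℝ) := by
      field_simp
      ring
    simp only [hp, gaussianPDFReal, e1, e2]
    field_simp
  rw [hlim] at key
  refine key.congr fun L => ?_
  rw [integral_gaussianReal_eq_integral_smul hv]
  exact (hsum L).tsum_eq

/-- The limiting expectation (37) behind Proposition 1: for `ω ~ N(0, σ²)` and positive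
integers `M_t, M_r`, at least one of which is even,
`lim_{L→∞} E[F_L(2(cos(φ+ω) − cos φ))·F_{M_t}(cos(φ+ω) − cos φ)·F_{M_r}(cos(φ+ω) − cos φ)]
  = M_t·M_r·h(φ, σ²)`. -/
theorem stmt14 (φ σ : ℝ) (hφ : φ ∈ Set.Ioo 0 Real.pi) (hσ : 0 < σ)
    (Mt Mr : ℕ) (hMt : 1 ≤ Mt) (hMr : 1 ≤ Mr) (heven : Even Mt ∨ Even Mr) :
    Tendsto (fun L : ℕ =>
        ∫ ω, fejer L (2 * (Real.cos (φ + ω) - Real.cos φ)) *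
            fejer Mt (Real.cos (φ + ω) - Real.cos φ) *
            fejer Mr (Real.cos (φ + ω) - Real.cos φ)
          ∂(gaussianReal 0 ⟨σ ^ 2, sq_nonneg σ⟩))
      atTop (nhds ((Mt : ℝ) * (Mr : ℝ) * hfun φ (σ ^ 2))) := by
  have hv : (⟨σ ^ 2, sq_nonneg σ⟩ : NNReal) ≠ 0 := fun h => by
    have := congrArg NNReal.toReal h
    exact (pow_pos hσ 2).ne' this
  rcases heven with h | h
  · exact tendsto_integral_echoGain_gaussianReal hφ hv (by lia) (by lia) h
  · rw [mul_comm (Mt : ℝ)]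
    refine (tendsto_integral_echoGain_gaussianReal hφ hv (M := Mr) (N := Mt)
      (by lia) (by lia) h).congr fun L => ?_
    simp only [echoGain, mul_right_comm]
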